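/- arXiv:2303.04777 — 4 statements merged into one kernel-verified Lean document; each statement's English description precedes it below -/
import Mathlib

section
/- Let k, l ≥ 1 and let M, Ξ ∈ ℝ^{(k+l)×(k+l)} be symmetric matrices, partitioned into blocks M₁₁, Ξ₁₁ ∈ ℝ^{k×k}, M₁₂, Ξ₁₂ ∈ ℝ^{k×l}, M₂₂, Ξ₂₂ ∈ ℝ^{l×l}. Assume: (i) M₁₂ = 0 and M₂₂ ⪯ 0; (ii) Ξ₂₂ ⪯ 0; (iii) there exists G ∈ ℝ^{l×k} such that Ξ₂₂ G = Ξ₁₂ᵀ, Ξ₁₁ = Gᵀ Ξ₂₂ G, and M₁₁ + Gᵀ M₂₂ G ≻ 0. Then the following are equivalent: (a) for every Z ∈ ℝ^{l×k} with S(Z)ᵀ Ξ S(Z) = 0 one has S(Z)ᵀ M S(Z) ⪰ 0, where S(Z) ∈ ℝ^{(k+l)×k} is the matrix obtained by stacking the identity I_k on top of Z; (b) there exists ε ∈ ℝ such that M − εΞ ⪰ 0. -/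
open Matrix

open scoped MatrixOrder in
lemma finsler_factor {l : ℕ} {P : Matrix (Fin l) (Fin l) ℝ} (hP : P.PosSemidef) :
    ∃ B : Matrix (Fin l) (Fin l) ℝ, P = Bᵀ * B := by
  obtain ⟨B, h⟩ := CStarAlgebra.nonneg_iff_eq_star_mul_self.mp hP.nonneg
  exact ⟨B, by simpa [star_eq_conjTranspose] using h⟩

lemma finsler_dot {l : ℕ} (B : Matrix (Fin l) (Fin l) ℝ) (x : Fin l → ℝ) :
    x ⬝ᵥ (Bᵀ * B) *ᵥ x = (B *ᵥ x) ⬝ᵥ (B *ᵥ x) := by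
  rw [← mulVec_mulVec, dotProduct_mulVec, vecMul_transpose]

lemma finsler_dom {l : ℕ} {P R : Matrix (Fin l) (Fin l) ℝ} (hP : P.PosSemidef)
    (hR : R.PosSemidef) (h : ∀ v, P *ᵥ v = 0 → R *ᵥ v = 0) :
    ∃ ε : ℝ, (ε • P - R).PosSemidef := by
  obtain ⟨B, rfl⟩ := finsler_factor hP
  obtain ⟨T, rfl⟩ := finsler_factor hR
  have key : ∀ v, B *ᵥ v = 0 → T *ᵥ v = 0 := by
    intro v hv
    have h1 := h v (by rw [← mulVec_mulVec, hv, mulVec_zero])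
    have h2 := finsler_dot T v
    rw [h1, dotProduct_zero] at h2
    exact dotProduct_self_eq_zero.mp h2.symm
  have hD : ∀ i, ∃ c : Fin l → ℝ, ∀ x, (T *ᵥ x) i = c ⬝ᵥ (B *ᵥ x) := by
    intro i
    have hm := mem_span_of_iInf_ker_le_ker (𝕜 := ℝ)
      (L := fun j => (LinearMap.proj j : (Fin l → ℝ) →ₗ[ℝ] ℝ).comp B.mulVecLin)
      (K := (LinearMap.proj i : (Fin l → ℝ) →ₗ[ℝ] ℝ).comp T.mulVecLin) (by
        intro v hv
        simp only [Submodule.mem_iInf, LinearMap.mem_ker, LinearMap.comp_apply,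
          LinearMap.proj_apply, mulVecLin_apply] at hv ⊢
        rw [key v (funext hv)]; rfl)
    obtain ⟨c, hc⟩ := (Submodule.mem_span_range_iff_exists_fun ℝ).1 hm
    refine ⟨c, fun x => ?_⟩
    have := LinearMap.congr_fun hc x
    simp only [LinearMap.sum_apply, LinearMap.smul_apply, LinearMap.comp_apply,
          LinearMap.proj_apply, mulVecLin_apply, smul_eq_mul] at this
    rw [← this]; rfl
  choose D hD using hD
  refine ⟨∑ i, ∑ j, D i j ^ 2, .of_dotProduct_mulVec_nonneg ?_ ?_⟩
  · refine IsHermitian.sub ?_ hR.1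
    have := hP.1
    unfold IsHermitian at *
    rw [conjTranspose_smul, this]; simp
  · intro x
    rw [star_trivial, sub_mulVec, smul_mulVec, dotProduct_sub, dotProduct_smul, finsler_dot,
      finsler_dot, sub_nonneg, smul_eq_mul, Finset.sum_mul, dotProduct]
    refine Finset.sum_le_sum fun i _ => ?_
    rw [hD, ← sq]
    refine (Finset.sum_mul_sq_le_sq_mul_sq _ _ _).trans (le_of_eq ?_)
    simp only [dotProduct, sq]

lemma finsler_expand {k l : ℕ} (A : Matrix (Fin k) (Fin k) ℝ)
    (B : Matrix (Fin k) (Fin l) ℝ) (D : Matrix (Fin l) (Fin l) ℝ) (Z : Matrix (Fin l) (Fin k) ℝ) :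
    (fromRows (1 : Matrix (Fin k) (Fin k) ℝ) Z)ᵀ * (fromBlocks A B Bᵀ D) *
      (fromRows (1 : Matrix (Fin k) (Fin k) ℝ) Z) = A + B * Z + Zᵀ * (Bᵀ + D * Z) := by
  rw [Matrix.mul_assoc, transpose_fromRows, fromBlocks_mul_fromRows, fromCols_mul_fromRows]
  simp


/-- Matrix Finsler's lemma (van Waarde et al.), Lemma 1 of the paper. -/
theorem matrix_finsler_lemma
    (k l : ℕ) (hk : 1 ≤ k) (hl : 1 ≤ l)
    (M11 Ξ11 : Matrix (Fin k) (Fin k) ℝ)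
    (M12 Ξ12 : Matrix (Fin k) (Fin l) ℝ)
    (M22 Ξ22 : Matrix (Fin l) (Fin l) ℝ)
    (hM11 : M11.IsHermitian) (hM22 : M22.IsHermitian)
    (hΞ11 : Ξ11.IsHermitian) (hΞ22 : Ξ22.IsHermitian)
    (hM12 : M12 = 0) (hM22n : (-M22).PosSemidef)
    (hΞ22n : (-Ξ22).PosSemidef)
    (G : Matrix (Fin l) (Fin k) ℝ)
    (hG1 : Ξ22 * G = Ξ12ᵀ)
    (hG2 : Ξ11 = Gᵀ * Ξ22 * G)
    (hG3 : (M11 + Gᵀ * M22 * G).PosDef) :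
    (∀ Z : Matrix (Fin l) (Fin k) ℝ,
        (fromRows (1 : Matrix (Fin k) (Fin k) ℝ) Z)ᵀ *
            (fromBlocks Ξ11 Ξ12 Ξ12ᵀ Ξ22) *
            (fromRows (1 : Matrix (Fin k) (Fin k) ℝ) Z) = 0 →
        ((fromRows (1 : Matrix (Fin k) (Fin k) ℝ) Z)ᵀ *
            (fromBlocks M11 M12 M12ᵀ M22) *
            (fromRows (1 : Matrix (Fin k) (Fin k) ℝ) Z)).PosSemidef)
      ↔ ∃ ε : ℝ,
          ((fromBlocks M11 M12 M12ᵀ M22) - ε • (fromBlocks Ξ11 Ξ12 Ξ12ᵀ Ξ22)).PosSemidef := by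

  subst hM12
  have hΞ12 : Ξ12 = Gᵀ * Ξ22 := by
    have := congrArg transpose hG1
    rw [transpose_mul, transpose_transpose] at this
    have h2 : Ξ22ᵀ = Ξ22 := by simpa [IsHermitian] using hΞ22
    rw [← this, h2]
  have hM22t : M22ᵀ = M22 := by simpa [IsHermitian] using hM22
  have hΞ22t : Ξ22ᵀ = Ξ22 := by simpa [IsHermitian] using hΞ22
  constructor
  · intro ha
    have ker : ∀ v, Ξ22 *ᵥ v = 0 → M22 *ᵥ v = 0 := by
      intro v hv
      let x : Fin k → ℝ := Pi.single ⟨0, hk⟩ 1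
      have hx : x ⬝ᵥ x = 1 := by simp [x]
      have hZ : ∀ t : ℝ, 0 ≤ x ⬝ᵥ M11 *ᵥ x + (t • v - G *ᵥ x) ⬝ᵥ M22 *ᵥ (t • v - G *ᵥ x) := by
        intro t
        have h0 : Ξ22 * vecMulVec v x = 0 := by
          rw [mul_vecMulVec, hv]; simp
        have h1 := ha (t • vecMulVec v x - G) (by
          rw [finsler_expand, hΞ12, hG2, transpose_mul, hΞ22t, transpose_transpose,
            Matrix.mul_sub, Matrix.mul_sub, Matrix.mul_smul, Matrix.mul_smul, h0,
            Matrix.mul_assoc _ _ (vecMulVec v x), h0]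
          simp)
        have h2 := h1.dotProduct_mulVec_nonneg x
        have h3 : (t • vecMulVec v x - G) *ᵥ x = t • v - G *ᵥ x := by
          rw [sub_mulVec, smul_mulVec, vecMulVec_mulVec, hx]; simp
        rw [finsler_expand, star_trivial] at h2
        simp only [Matrix.zero_mul, transpose_zero, add_zero, zero_add, add_mulVec, dotProduct_add,
          ← mulVec_mulVec, h3] at h2
        rwa [dotProduct_mulVec x (_ᵀ), vecMul_transpose, h3] at h2
      have hq := hM22n.dotProduct_mulVec_nonneg v
      have hg := hM22n.dotProduct_mulVec_nonneg (G *ᵥ x)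
      rw [star_trivial] at hq hg
      have hz := (hM22n.dotProduct_mulVec_zero_iff v).1
      rw [star_trivial] at hz
      simp only [neg_mulVec, dotProduct_neg, neg_eq_zero] at hq hg hz
      apply hz
      simp only [mulVec_sub, mulVec_smul, dotProduct_sub, sub_dotProduct, dotProduct_smul,
        smul_dotProduct, smul_eq_mul] at hZ
      generalize v ⬝ᵥ M22 *ᵥ v = q at *
      generalize (G *ᵥ x) ⬝ᵥ M22 *ᵥ (G *ᵥ x) = g at *
      generalize x ⬝ᵥ M11 *ᵥ x = c at *
      have hs : ∀ t : ℝ, 0 ≤ c + t ^ 2 * q := by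
        intro t
        have h1 := hZ t
        have h2 := hZ (-t)
        nlinarith
      by_contra hne
      have hqn : q < 0 := lt_of_le_of_ne (by linarith) hne
      have hc : 0 ≤ c := by simpa using hs 0
      have h1 := hs ((c + 1) / (-q) + 1)
      have h2 : (c + 1) / (-q) * q = -(c + 1) := by field_simp
      have h3 : 0 < (c + 1) / (-q) := div_pos (by linarith) (by linarith)
      generalize (c + 1) / (-q) = s at *
      nlinarith [mul_pos h3 (by linarith : 0 < c + 1)]
    set A := M11 + Gᵀ * M22 * G with hA
    have : Invertible A := hG3.isUnit.invertible
    have hR : (-M22 + (Gᵀ * M22)ᵀ * A⁻¹ * (Gᵀ * M22)).PosSemidef := by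
      refine hM22n.add ?_
      simpa using hG3.inv.posSemidef.conjTranspose_mul_mul_same (Gᵀ * M22)
    obtain ⟨ε, hε⟩ := finsler_dom hΞ22n hR (by
      intro v hv
      have hv' := ker v (by simpa [neg_mulVec] using hv)
      simp [add_mulVec, neg_mulVec, ← mulVec_mulVec, hv'])
    refine ⟨ε, ?_⟩
    have hN := (PosDef.fromBlocks₁₁ (-(Gᵀ * M22)) (M22 - ε • Ξ22) hG3).2 (by
      have e : ∀ X : Matrix (Fin l) (Fin l) ℝ, X = ε • -Ξ22 -
          (-M22 + (Gᵀ * M22)ᵀ * A⁻¹ * (Gᵀ * M22)) → X.PosSemidef := fun X h => h ▸ hε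
      apply e
      simp only [conjTranspose_eq_transpose_of_trivial, transpose_neg, Matrix.neg_mul,
        Matrix.mul_neg, smul_neg]
      abel)
    have hL := hN.conjTranspose_mul_mul_same (fromBlocks (1 : Matrix (Fin k) (Fin k) ℝ) 0 G (1 : Matrix (Fin l) (Fin l) ℝ))
    have e : ∀ X Y : Matrix (Fin k ⊕ Fin l) (Fin k ⊕ Fin l) ℝ, Y.PosSemidef → X = Y →
        X.PosSemidef := fun X Y hY h => h ▸ hY
    refine e _ _ hL ?_
    rw [conjTranspose_eq_transpose_of_trivial, conjTranspose_eq_transpose_of_trivial,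
      fromBlocks_transpose, fromBlocks_multiply, fromBlocks_multiply, fromBlocks_smul, 
      sub_eq_add_neg, fromBlocks_neg, fromBlocks_add, hΞ12, hG2, hA]
    simp only [transpose_mul, transpose_neg, transpose_transpose, hM22t, hΞ22t, transpose_one,
      transpose_zero, Matrix.one_mul, Matrix.mul_one, Matrix.zero_mul, Matrix.mul_zero, zero_add,
      add_zero, Matrix.mul_add, Matrix.add_mul, Matrix.mul_sub, Matrix.sub_mul, Matrix.neg_mul,
      Matrix.mul_neg, Matrix.mul_smul, Matrix.smul_mul, Matrix.mul_assoc]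
    congr 1 <;> abel
  · rintro ⟨ε, hε⟩ Z hZ
    have := hε.conjTranspose_mul_mul_same (fromRows (1 : Matrix (Fin k) (Fin k) ℝ) Z)
    rw [conjTranspose_eq_transpose_of_trivial, Matrix.mul_sub, Matrix.sub_mul, Matrix.mul_smul,
      Matrix.smul_mul, hZ, smul_zero, sub_zero] at this
    exact this
end

section
/- Let n ≥ 1, let P ∈ ℝ^{n×n} be symmetric positive definite, let α > 0, and let w₁, …, w_r ∈ ℝⁿ. Then the ellipsoid E(α) = {x ∈ ℝⁿ : xᵀPx ≤ α} is contained in the set W = {x ∈ ℝⁿ : ⟨w_i, x⟩ ≤ 1 for all i = 1, …, r} if and only if α · w_iᵀ P⁻¹ w_i ≤ 1 for all i = 1, …, r. -/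
open Matrix

/-- Lemma 2 of the paper (Boyd et al.): the ellipsoid {x : xᵀPx ≤ α} is contained
in {x : ⟨wᵢ, x⟩ ≤ 1 ∀ i} iff α wᵢᵀ P⁻¹ wᵢ ≤ 1 for all i. -/
theorem ellipsoid_in_polyhedron
    (n r : ℕ) (hn : 1 ≤ n) (hr : 1 ≤ r)
    (P : Matrix (Fin n) (Fin n) ℝ) (hP : P.PosDef) (hPsymm : P.IsHermitian)
    (α : ℝ) (hα : 0 < α)
    (w : Fin r → Fin n → ℝ) :
    ({x : Fin n → ℝ | x ⬝ᵥ P *ᵥ x ≤ α} ⊆ {x : Fin n → ℝ | ∀ i, w i ⬝ᵥ x ≤ 1})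
      ↔ ∀ i, α * (w i ⬝ᵥ P⁻¹ *ᵥ w i) ≤ 1 := by
  have hnn : ∀ x : Fin n → ℝ, 0 ≤ x ⬝ᵥ P *ᵥ x := fun x => by
    simpa using hP.posSemidef.dotProduct_mulVec_nonneg x
  have hPt : Pᵀ = P := by
    have h := hPsymm.eq
    rwa [conjTranspose_eq_transpose_of_trivial] at h
  have hsym : ∀ x y : Fin n → ℝ, x ⬝ᵥ P *ᵥ y = y ⬝ᵥ P *ᵥ x := fun x y => by
    rw [dotProduct_mulVec, ← mulVec_transpose, hPt, dotProduct_comm]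
  have hdet : IsUnit P.det := (isUnit_iff_isUnit_det P).1 hP.isUnit
  have hw : ∀ i, P *ᵥ (P⁻¹ *ᵥ w i) = w i := fun i => by
    rw [mulVec_mulVec, mul_nonsing_inv _ hdet, one_mulVec]
  constructor
  · intro h i
    have hv := hw i
    set v := P⁻¹ *ᵥ w i with hvdef
    have hs : v ⬝ᵥ P *ᵥ v = w i ⬝ᵥ v := by rw [hv, dotProduct_comm]
    have hs0 : 0 ≤ w i ⬝ᵥ v := hs ▸ hnn v
    rcases hs0.eq_or_lt with h0 | h0
    · rw [← h0]; simp
    · have hc0 := Real.sqrt_nonneg (α / (w i ⬝ᵥ v))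
      have hc := Real.sq_sqrt (div_pos hα h0).le
      set c := Real.sqrt (α / (w i ⬝ᵥ v)) with hcdef
      have hc2 : c ^ 2 * (w i ⬝ᵥ v) = α := by
        rw [hc]; field_simp
      have hx : c • v ∈ {x : Fin n → ℝ | x ⬝ᵥ P *ᵥ x ≤ α} := by
        simp only [Set.mem_setOf_eq, mulVec_smul, smul_dotProduct, dotProduct_smul, smul_eq_mul, hs]
        nlinarith
      have h1 : w i ⬝ᵥ (c • v) ≤ 1 := h hx i
      rw [dotProduct_smul, smul_eq_mul] at h1
      have h2 : 0 ≤ c * (w i ⬝ᵥ v) := mul_nonneg hc0 hs0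
      have h3 : α * (w i ⬝ᵥ v) = (c * (w i ⬝ᵥ v)) ^ 2 := by
        rw [← hc2]; ring
      rw [h3]
      exact pow_le_one₀ h2 h1
  · intro h x hx i
    have hx' : x ⬝ᵥ P *ᵥ x ≤ α := hx
    have hi := h i
    have hv := hw i
    set v := P⁻¹ *ᵥ w i with hvdef
    have h1 := hnn (x - α • v)
    have h2 := hsym v x
    simp only [mulVec_sub, mulVec_smul, sub_dotProduct, dotProduct_sub, smul_dotProduct,
      dotProduct_smul, smul_eq_mul, h2, hv, dotProduct_comm v (w i),
      dotProduct_comm x (w i)] at h1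
    nlinarith [mul_le_mul_of_nonneg_left hi hα.le]
end

section
/- Let n, m ≥ 1, let N ∈ ℝ^{n×n} be symmetric positive definite, let L ∈ ℝ^{m×n}, let c ∈ ℝ^{1×n} and d ∈ ℝ^{1×m} be row vectors. If the symmetric (1+n)×(1+n) block matrix with blocks (1,1) = 1, (1,2) = dL + cN, (2,1) = (dL + cN)ᵀ, (2,2) = N is positive definite, then for every x ∈ ℝⁿ with xᵀ N⁻¹ x ≤ 1 one has c x + d (L N⁻¹) x ≤ 1. -/
open Matrix

/-- The constraint LMI (28e) guarantees the mixed state-input constraint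
cx + du ≤ 1 with u = (LN⁻¹)x on the ellipsoid {x : xᵀN⁻¹x ≤ 1}. -/
theorem constraint_lmi_implies_constraint
    (n m : ℕ) (hn : 1 ≤ n) (hm : 1 ≤ m)
    (N : Matrix (Fin n) (Fin n) ℝ) (hN : N.PosDef)
    (L : Matrix (Fin m) (Fin n) ℝ)
    (c : Matrix (Fin 1) (Fin n) ℝ) (d : Matrix (Fin 1) (Fin m) ℝ)
    (h : (fromBlocks (1 : Matrix (Fin 1) (Fin 1) ℝ) (d * L + c * N)
          (d * L + c * N)ᵀ N).PosDef) :
    ∀ x : Fin n → ℝ, x ⬝ᵥ N⁻¹ *ᵥ x ≤ 1 →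
      (c *ᵥ x) 0 + (d *ᵥ ((L * N⁻¹) *ᵥ x)) 0 ≤ 1 := by
  intro x hx
  have hdet : IsUnit N.det := hN.isUnit.map Matrix.detMonoidHom
  have hNx : N *ᵥ (N⁻¹ *ᵥ x) = x := by
    rw [mulVec_mulVec, mul_nonsing_inv N hdet, one_mulVec]
  have key := h.posSemidef.dotProduct_mulVec_nonneg
    (Sum.elim (fun _ => (1 : ℝ)) (-(N⁻¹ *ᵥ x)))
  have hg : (c *ᵥ x) 0 + (d *ᵥ ((L * N⁻¹) *ᵥ x)) 0
      = ((d * L + c * N) *ᵥ (N⁻¹ *ᵥ x)) 0 := by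
    rw [add_mulVec, ← mulVec_mulVec _ c N, hNx, ← mulVec_mulVec _ d L,
      ← mulVec_mulVec _ L N⁻¹, Pi.add_apply, add_comm]
  rw [hg]
  generalize d * L + c * N = B at *
  generalize N⁻¹ *ᵥ x = y at *
  rw [star_trivial, fromBlocks_mulVec, sumElim_dotProduct_sumElim] at key
  simp only [Sum.elim_comp_inl, Sum.elim_comp_inr, mulVec_neg, hNx, one_mulVec,
    dotProduct_add, neg_dotProduct, dotProduct_neg, neg_neg] at key
  have e1 : (fun _ : Fin 1 => (1:ℝ)) ⬝ᵥ (fun _ => 1) = 1 := by simp [dotProduct]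
  have e2 : (fun _ : Fin 1 => (1:ℝ)) ⬝ᵥ B *ᵥ y = (B *ᵥ y) 0 := by simp [dotProduct]
  have e3 : y ⬝ᵥ Bᵀ *ᵥ (fun _ : Fin 1 => (1:ℝ)) = (B *ᵥ y) 0 := by
    rw [mulVec_transpose, dotProduct_comm, ← dotProduct_mulVec, e2]
  rw [e1, e2, e3, dotProduct_comm y x] at key
  linarith
end

section
/- Let n, m ≥ 1, let P ∈ ℝ^{n×n} be symmetric positive definite, let Q ∈ ℝ^{n×n} and R ∈ ℝ^{m×m} be symmetric positive definite, let A ∈ ℝ^{n×n}, B ∈ ℝ^{n×m}, K ∈ ℝ^{m×n}, let E ∈ ℝⁿ, h ∈ ℝⁿ, and β > 0. Set A_K := A + BK. Suppose the symmetric (n+1)×(n+1) block matrix with blocks (1,1) = P − A_Kᵀ P A_K − Q − Kᵀ R K ∈ ℝ^{n×n}, (1,2) = −A_Kᵀ P E − (β/2) h ∈ ℝⁿ, (2,1) = (1,2)ᵀ, (2,2) = 1 − Eᵀ P E ∈ ℝ is positive definite. Then for every x ∈ ℝⁿ and w ∈ ℝ with w (β⟨h, x⟩ − w) ≥ 0 and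 (x, w) ≠ (0, 0), one has (A_K x + w E)ᵀ P (A_K x + w E) − xᵀ P x < −(xᵀ Q x + (Kx)ᵀ R (Kx)). -/
open Matrix

/-- The S-procedure step in the proof of Theorem 3: the multiplier LMI implies
strict Lyapunov decrease for all (x, w) compatible with the sector bound. -/
theorem s_procedure_lure
    (n m : ℕ) (hn : 1 ≤ n) (hm : 1 ≤ m)
    (P : Matrix (Fin n) (Fin n) ℝ) (hP : P.PosDef)
    (Q : Matrix (Fin n) (Fin n) ℝ) (hQ : Q.PosDef)
    (R : Matrix (Fin m) (Fin m) ℝ) (hR : R.PosDef)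
    (A : Matrix (Fin n) (Fin n) ℝ) (B : Matrix (Fin n) (Fin m) ℝ)
    (K : Matrix (Fin m) (Fin n) ℝ)
    (E h : Fin n → ℝ) (β : ℝ) (hβ : 0 < β)
    (hlmi : (fromBlocks
        (P - (A + B * K)ᵀ * P * (A + B * K) - Q - Kᵀ * R * K)
        (Matrix.of fun (i : Fin n) (_ : Fin 1) =>
          (-(((A + B * K)ᵀ * P) *ᵥ E) - (β / 2) • h) i)
        (Matrix.of fun (_ : Fin 1) (i : Fin n) =>
          (-(((A + B * K)ᵀ * P) *ᵥ E) - (β / 2) • h) i)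
        ((1 - E ⬝ᵥ P *ᵥ E) • (1 : Matrix (Fin 1) (Fin 1) ℝ))).PosDef) :
    ∀ (x : Fin n → ℝ) (w : ℝ),
      w * (β * (h ⬝ᵥ x) - w) ≥ 0 → ¬(x = 0 ∧ w = 0) →
      ((A + B * K) *ᵥ x + w • E) ⬝ᵥ P *ᵥ ((A + B * K) *ᵥ x + w • E)
          - x ⬝ᵥ P *ᵥ x
        < -(x ⬝ᵥ Q *ᵥ x + (K *ᵥ x) ⬝ᵥ R *ᵥ (K *ᵥ x)) := by
  intro x w hw hne
  have hz : (Sum.elim x (fun _ : Fin 1 => w)) ≠ 0 := by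
    intro h0
    apply hne
    constructor
    · funext i
      exact congrFun h0 (Sum.inl i)
    · exact congrFun h0 (Sum.inr 0)
  have key := hlmi.dotProduct_mulVec_pos hz
  generalize A + B * K = F at *
  have hPt : Pᵀ = P := by simpa using hP.1.eq
  have e1 : (Matrix.of fun (i : Fin n) (_ : Fin 1) =>
          (-((Fᵀ * P) *ᵥ E) - (β / 2) • h) i) *ᵥ (fun _ : Fin 1 => w)
      = w • (-((Fᵀ * P) *ᵥ E) - (β / 2) • h) := by
    funext i
    simp [mulVec, dotProduct, mul_comm]
  have e2 : (Matrix.of fun (_ : Fin 1) (i : Fin n) =>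
          (-((Fᵀ * P) *ᵥ E) - (β / 2) • h) i) *ᵥ x
      = fun _ => (-((Fᵀ * P) *ᵥ E) - (β / 2) • h) ⬝ᵥ x := rfl
  have e3 : ∀ (a b : Fin 1 → ℝ), a ⬝ᵥ b = a 0 * b 0 := by
    intro a b
    simp [dotProduct]
  have t1 : ∀ {k : ℕ} (M : Matrix (Fin k) (Fin n) ℝ) (v : Fin k → ℝ),
      x ⬝ᵥ (Mᵀ *ᵥ v) = (M *ᵥ x) ⬝ᵥ v := by
    intro k M v
    rw [dotProduct_mulVec, vecMul_transpose]
  have t2 : E ⬝ᵥ P *ᵥ (F *ᵥ x) = (F *ᵥ x) ⬝ᵥ P *ᵥ E := by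
    rw [dotProduct_mulVec, ← mulVec_transpose, hPt, dotProduct_comm]
  rw [star_trivial, fromBlocks_mulVec, sumElim_dotProduct_sumElim] at key
  simp only [Sum.elim_comp_inl, Sum.elim_comp_inr] at key
  rw [e1, e2, e3] at key
  rw [dotProduct_comm _ x] at key
  simp only [sub_mulVec, ← mulVec_mulVec, dotProduct_add, dotProduct_sub, dotProduct_neg,
    dotProduct_smul, t1, smul_mulVec, one_mulVec, Pi.add_apply, Pi.smul_apply,
    smul_eq_mul, dotProduct_comm x h] at key
  simp only [mulVec_add, mulVec_smul, dotProduct_add, add_dotProduct, smul_dotProduct,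
    dotProduct_smul, smul_eq_mul, t2]
  linarith
end
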